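/- arXiv:2312.10627 — 2 statements merged into one kernel-verified Lean document; each statement's English description precedes it below -/
import Mathlib

section
/- Let N ≥ 3 and k ≥ 3 be integers, let λ = (λ₁, λ₂) ∈ ℤ² with gcd(λ₁, λ₂, N) = 1, let p be a prime with p ∤ N, and let e ∈ ℤ with p·e ≡ 1 (mod N). Then for every τ in the upper half-plane: p^{k−1}·E_k^{(1)}((eλ₁, pλ₂), N)(pτ) + (1/p)·Σ_{j=0}^{p−1} E_k^{(1)}(λ, N)((τ+j)/p) = p^{k−1}·E_k^{(1)}((λ₁, pλ₂), N)(τ) + E_k^{(1)}((eλ₁, λ₂), N)(τ). (The left-hand side is the level-Γ₁(N) Hecke operator T_p applied to E_k^{(1)}(λ, N), so this says T_p E_k^{(1)}(λ̄) = p^{k−1}·E_k^{(1)}((λ̄₁, p̄λ̄₂)) + E_k^{(1)}((p̄^{-1}λ̄₁, λ̄₂)).) -/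
open Complex UpperHalfPlane

noncomputable section

def epsN (N : ℕ) : ℂ := if 3 ≤ N then 1 else 1/2

/-- normalized Eisenstein series of weight `k` on `Γ(N)` -/
def Ek (k N : ℕ) (lam : ZMod N × ZMod N) : ℍ → ℂ :=
  fun τ => epsN N * ∑' cd : ℤ × ℤ,
    if Int.gcd cd.1 cd.2 = 1 ∧ (cd.1 : ZMod N) = lam.1 ∧ (cd.2 : ZMod N) = lam.2
    then ((cd.1 : ℂ) * (τ : ℂ) + (cd.2 : ℂ)) ^ (-(k : ℤ)) else 0

/-- the orbital sum `E_k^{(1)}(λ, N)` for `Γ₁(N)`. -/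
def Ek1 (k N : ℕ) (lam : ℤ × ℤ) : ℍ → ℂ :=
  fun τ => ∑ n ∈ Finset.range (N / Int.gcd lam.1 (N : ℤ)),
    Ek k N ((lam.1 : ZMod N),
      ((lam.2 + (Int.gcd lam.1 (N : ℤ) : ℤ) * (n : ℤ) : ℤ) : ZMod N)) τ

/-- the point `p·τ` of `ℍ`, for a positive natural `p`. -/
def scaleH (p : ℕ) (hp : 0 < p) (τ : ℍ) : ℍ :=
  ⟨(p : ℂ) * (τ : ℂ), by
    have h : ((p : ℂ) * (τ : ℂ)).im = (p : ℝ) * (τ : ℂ).im := by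
      simp [Complex.mul_im]
    rw [h]
    exact mul_pos (by exact_mod_cast hp) τ.2⟩

/-- the point `(τ+j)/p` of `ℍ`, for a positive natural `p` and `j : ℕ`. -/
def shiftH (j p : ℕ) (hp : 0 < p) (τ : ℍ) : ℍ :=
  ⟨((τ : ℂ) + (j : ℂ)) / (p : ℂ), by
    have h : (((τ : ℂ) + (j : ℂ)) / (p : ℂ)).im = (τ : ℂ).im / (p : ℝ) := by
      rw [show ((p : ℂ)) = ((p : ℝ) : ℂ) by push_cast; ring, Complex.div_ofReal_im]
      simp
    rw [h]
    exact div_pos τ.2 (by exact_mod_cast hp)⟩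

/-- The coprime pairs `(c, d)` with `c ≡ a` mod `N` and `d ≡ b` mod `m`. -/
def coprimePairs (N m : ℕ) (a b : ℤ) : Set (ℤ × ℤ) :=
  {x | IsCoprime x.1 x.2 ∧ (N : ℤ) ∣ x.1 - a ∧ (m : ℤ) ∣ x.2 - b}

/-- The lattice summand `(cτ + d)^{-k}`. -/
def latticeTerm (k : ℕ) (z : ℂ) (x : ℤ × ℤ) : ℂ := ((x.1 : ℂ) * z + (x.2 : ℂ)) ^ (-(k : ℤ))

lemma summable_latticeTerm {k : ℕ} (hk : 3 ≤ k) (τ : ℍ) : Summable (latticeTerm k τ) := by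
  have h := (EisensteinSeries.summable_norm_eisSummand (k := (k : ℤ))
    (by exact_mod_cast hk) τ).of_norm
  rw [← (finTwoArrowEquiv ℤ).symm.summable_iff] at h
  refine h.congr fun x => ?_
  simp [latticeTerm, EisensteinSeries.eisSummand, finTwoArrowEquiv]

open Classical in
/-- Summing over a residue class mod a divisor `m` of `N` splits over the classes mod `N`. -/
lemma sum_ite_dvd_sub_mul {N m : ℕ} (hN : 0 < N) (hm : m ∣ N) (t : ℤ) (z : ℂ) :
    ∑ n ∈ Finset.range (N / m), (if (N : ℤ) ∣ t - m * n then z else 0) =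
      if (m : ℤ) ∣ t then z else 0 := by
  obtain ⟨q, rfl⟩ := hm
  have hm0 : 0 < m := Nat.pos_of_mul_pos_right hN
  have hq0 : 0 < q := Nat.pos_of_mul_pos_left hN
  rw [Nat.mul_div_cancel_left q hm0]
  have hmz : (m : ℤ) ≠ 0 := by exact_mod_cast hm0.ne'
  have hqz : (0 : ℤ) < q := by exact_mod_cast hq0
  split_ifs with h
  · obtain ⟨s, rfl⟩ := h
    have key (n : ℕ) : ((m * q : ℕ) : ℤ) ∣ m * s - m * n ↔ (q : ℤ) ∣ s - n := by
      rw [← mul_sub, Nat.cast_mul]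
      exact mul_dvd_mul_iff_left hmz
    simp only [key]
    have h0 := Int.emod_nonneg s hqz.ne'
    have h1 := Int.emod_lt_of_pos s hqz
    rw [Finset.sum_eq_single (s % q).toNat]
    · rw [if_pos]
      rw [Int.toNat_of_nonneg h0]
      exact Int.dvd_self_sub_emod
    · intro n hn hne
      rw [if_neg]
      intro hd
      apply hne
      have hn' : (n : ℤ) < q := by exact_mod_cast Finset.mem_range.1 hn
      have h2 : s % q = n % q :=
        Int.emod_eq_emod_iff_emod_sub_eq_zero.2 (Int.emod_eq_zero_of_dvd hd)
      rw [Int.emod_eq_of_lt (by positivity) hn'] at h2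
      omega
    · intro hn
      exact absurd (Finset.mem_range.2 (by omega)) hn
  · refine Finset.sum_eq_zero fun n _ => if_neg fun hd => h ?_
    have h1 : (m : ℤ) ∣ t - m * n := (Int.natCast_dvd_natCast.2 (dvd_mul_right m q)).trans hd
    exact (Int.dvd_iff_dvd_of_dvd_sub h1).2 (dvd_mul_right _ _)

lemma Ek1_eq_tsum {N k : ℕ} (hN : 3 ≤ N) (hk : 3 ≤ k) (lam : ℤ × ℤ) (τ : ℍ) :
    Ek1 k N lam τ =
      ∑' x, (coprimePairs N (Int.gcd lam.1 N) lam.1 lam.2).indicator (latticeTerm k τ) x := by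
  classical
  have hsum := summable_latticeTerm hk τ
  have hEk (n : ℕ) : Ek k N ((lam.1 : ZMod N),
      ((lam.2 + (Int.gcd lam.1 (N : ℤ) : ℤ) * (n : ℤ) : ℤ) : ZMod N)) τ =
      ∑' x, (coprimePairs N N lam.1 (lam.2 + (Int.gcd lam.1 N : ℤ) * n)).indicator
        (latticeTerm k τ) x := by
    simp only [Ek, epsN, if_pos hN, one_mul]
    refine tsum_congr fun x => ?_
    rw [Set.indicator_apply]
    refine if_congr ?_ rfl rfl
    have h (a b : ℤ) : (a : ZMod N) = b ↔ (N : ℤ) ∣ a - b := by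
      rw [eq_comm, ZMod.intCast_eq_intCast_iff_dvd_sub]
    simp only [coprimePairs, Set.mem_ofPred_eq, Int.isCoprime_iff_gcd_eq_one, h]
  simp only [Ek1, hEk]
  rw [← Summable.tsum_finsetSum fun n _ => hsum.indicator _]
  refine tsum_congr fun x => ?_
  have hdvd : Int.gcd lam.1 N ∣ N := by
    exact_mod_cast Int.gcd_dvd_right lam.1 (N : ℤ)
  simp only [Set.indicator_apply, coprimePairs, Set.mem_ofPred_eq]
  by_cases hx : IsCoprime x.1 x.2 ∧ (N : ℤ) ∣ x.1 - lam.1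
  · simp only [hx.1, hx.2, true_and, ← sub_sub]
    exact sum_ite_dvd_sub_mul (by omega) hdvd _ _
  · simp only [← and_assoc, hx, false_and, if_false, Finset.sum_const_zero]

lemma tsum_indicator_comp {α β M : Type*} [AddCommMonoid M] [TopologicalSpace M]
    {φ : α → β} (hφ : Function.Injective φ) (S : Set α) (f : β → M) :
    ∑' x, S.indicator (f ∘ φ) x = ∑' y, (φ '' S).indicator f y := by
  rw [← hφ.tsum_eq (f := (φ '' S).indicator f)]
  · refine tsum_congr fun x => ?_
    classical
    simp only [Set.indicator_apply, hφ.mem_set_image, Function.comp]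
  · exact (Set.support_indicator_subset).trans (Set.image_subset_range _ _)

lemma card_filter_dvd_sub_mul {p : ℕ} (hp : p.Prime) {u : ℤ} (hu : ¬ (p : ℤ) ∣ u) (v : ℤ) :
    ((Finset.range p).filter fun j : ℕ => (p : ℤ) ∣ v - u * j).card = 1 := by
  have := Fact.mk hp
  have hu' : (u : ZMod p) ≠ 0 := by rwa [Ne, ZMod.intCast_zmod_eq_zero_iff_dvd]
  rw [Finset.card_eq_one]
  refine ⟨((v : ZMod p) / u).val, ?_⟩
  ext j
  simp only [Finset.mem_filter, Finset.mem_range, Finset.mem_singleton]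
  rw [← ZMod.intCast_zmod_eq_zero_iff_dvd]
  push_cast
  constructor
  · rintro ⟨hj, h⟩
    rw [sub_eq_zero.1 h, mul_div_cancel_left₀ _ hu', ZMod.val_cast_of_lt hj]
  · rintro rfl
    refine ⟨ZMod.val_lt _, ?_⟩
    rw [ZMod.natCast_zmod_val, mul_div_cancel₀ _ hu', sub_self]

open Classical in
/-- The number of index-`p` sublattice representations of a lattice point by coprime pairs. -/
lemma card_coprime_representations {p : ℕ} (hp : p.Prime) (u v : ℤ) :
    (if ∃ a, u = p * a ∧ IsCoprime a v then 1 else 0) +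
      ((Finset.range p).filter fun j : ℕ => ∃ d, v = u * j + p * d ∧ IsCoprime u d).card =
    (if IsCoprime u v then 1 else 0) +
      p * (if ∃ a b, u = p * a ∧ v = p * b ∧ IsCoprime a b then 1 else 0) := by
  have hpz : Prime (p : ℤ) := Nat.prime_iff_prime_int.1 hp
  have hp0 : (p : ℤ) ≠ 0 := hpz.ne_zero
  have hcop (t : ℤ) : IsCoprime (p : ℤ) t ↔ ¬ (p : ℤ) ∣ t := hpz.coprime_iff_not_dvd
  by_cases hu : (p : ℤ) ∣ u
  · obtain ⟨a, rfl⟩ := hu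
    have hA : (∃ a', (p : ℤ) * a = p * a' ∧ IsCoprime a' v) ↔ IsCoprime a v :=
      ⟨fun ⟨a', h, h'⟩ => mul_left_cancel₀ hp0 h ▸ h', fun h => ⟨a, rfl, h⟩⟩
    have hC : IsCoprime ((p : ℤ) * a) v ↔ ¬ (p : ℤ) ∣ v ∧ IsCoprime a v := by
      rw [IsCoprime.mul_left_iff, hcop]
    rw [if_congr hA rfl rfl, if_congr hC rfl rfl]
    by_cases hv : (p : ℤ) ∣ v
    · obtain ⟨b, rfl⟩ := hv
      have hB (j : ℕ) : (∃ d, (p : ℤ) * b = p * a * j + p * d ∧ IsCoprime (p * a) d) ↔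
          IsCoprime a b ∧ ¬ (p : ℤ) ∣ b - a * j := by
        have : IsCoprime a (b - a * j) ↔ IsCoprime a b := by
          rw [sub_eq_add_neg, ← mul_neg, IsCoprime.add_mul_left_right_iff]
        rw [← this, ← hcop, and_comm, ← IsCoprime.mul_left_iff]
        constructor
        · rintro ⟨d, h, h'⟩
          have : b = a * j + d := mul_left_cancel₀ hp0 (by linear_combination h)
          rwa [this, add_sub_cancel_left]
        · exact fun h => ⟨_, by ring, h⟩
      have hR : (∃ a' b', (p : ℤ) * a = p * a' ∧ (p : ℤ) * b = p * b' ∧ IsCoprime a' b') ↔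
          IsCoprime a b := by
        constructor
        · rintro ⟨a', b', h, h', h''⟩
          rwa [mul_left_cancel₀ hp0 h, mul_left_cancel₀ hp0 h']
        · exact fun h => ⟨a, b, rfl, rfl, h⟩
      simp only [hB, hR, IsCoprime.mul_right_iff, isCoprime_comm (x := a) (y := (p : ℤ)), hcop]
      by_cases hab : IsCoprime a b
      · have hcard := Finset.card_filter_add_card_filter_not (s := Finset.range p)
          (fun j : ℕ => (p : ℤ) ∣ b - a * j)
        rw [Finset.card_range] at hcard
        by_cases ha : (p : ℤ) ∣ a
        · have hb : ¬ (p : ℤ) ∣ b := fun hb => hpz.not_isUnit (hab.isUnit_of_dvd' ha hb)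
          have h0 : ((Finset.range p).filter fun j : ℕ => (p : ℤ) ∣ b - a * j).card = 0 := by
            rw [Finset.card_eq_zero, Finset.filter_eq_empty_iff]
            exact fun j _ h => hb ((Int.dvd_iff_dvd_of_dvd_sub h).2 (ha.mul_right _))
          simp [hab, ha]
          omega
        · have h1 := card_filter_dvd_sub_mul hp ha b
          simp [hab, ha]
          omega
      · simp [hab]
    · have hB (j : ℕ) : ¬ ∃ d, v = p * a * j + p * d ∧ IsCoprime (p * a) d := by
        rintro ⟨d, rfl, -⟩
        exact hv ⟨a * j + d, by ring⟩
      have hR : ¬ ∃ a' b', (p : ℤ) * a = p * a' ∧ v = p * b' ∧ IsCoprime a' b' := by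
        rintro ⟨a', b', -, rfl, -⟩
        exact hv (dvd_mul_right _ _)
      simp only [hB, hR, hv, if_false, not_false_eq_true, true_and, Finset.filter_false,
        Finset.card_empty, mul_zero]
  · have hA : ¬ ∃ a, u = p * a ∧ IsCoprime a v := by
      rintro ⟨a, rfl, -⟩
      exact hu (dvd_mul_right _ _)
    have hR : ¬ ∃ a b, u = p * a ∧ v = p * b ∧ IsCoprime a b := by
      rintro ⟨a, b, rfl, -⟩
      exact hu (dvd_mul_right _ _)
    have hB (j : ℕ) : (∃ d, v = u * j + p * d ∧ IsCoprime u d) ↔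
        IsCoprime u v ∧ (p : ℤ) ∣ v - u * j := by
      constructor
      · rintro ⟨d, rfl, h⟩
        refine ⟨?_, d, by ring⟩
        rw [add_comm, IsCoprime.add_mul_left_right_iff]
        exact IsCoprime.mul_right ((hcop u).2 hu).symm h
      · rintro ⟨h, d, hd⟩
        have hv : v = p * d + u * j := by linear_combination hd
        refine ⟨d, by linear_combination hd, ?_⟩
        rw [hv, IsCoprime.add_mul_left_right_iff] at h
        exact h.of_mul_right_right
    simp only [hA, hR, hB, if_false]
    by_cases h : IsCoprime u v
    · simpa [h] using card_filter_dvd_sub_mul hp hu v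
    · simp [h]

open Classical in
/-- The Hecke correspondence on coprime pairs: the images of the coprime pairs under the
representatives of index-`p` sublattices cover each lattice point with the stated multiplicity. -/
lemma indicator_hecke_eq {N m p : ℕ} (hp : p.Prime) (hpN : ¬ p ∣ N) (hm : m ∣ N) {a b e : ℤ}
    (ha : (m : ℤ) ∣ a) (he : (N : ℤ) ∣ p * e - 1) (f : ℤ × ℤ → ℂ) (y : ℤ × ℤ) :
    ((fun x : ℤ × ℤ => ((p : ℤ) * x.1, x.2)) ''
          coprimePairs N m (e * a) (p * b)).indicator f y +
      ∑ j ∈ Finset.range p, ((fun x : ℤ × ℤ => (x.1, x.1 * (j : ℤ) + p * x.2)) ''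
          coprimePairs N m a b).indicator f y =
    (coprimePairs N m a (p * b)).indicator f y +
      p * ((fun x : ℤ × ℤ => ((p : ℤ) * x.1, (p : ℤ) * x.2)) ''
          coprimePairs N m (e * a) b).indicator f y := by
  obtain ⟨u, v⟩ := y
  have hcopN : IsCoprime (N : ℤ) p :=
    (Nat.isCoprime_iff_coprime.2 ((hp.coprime_iff_not_dvd).2 hpN)).symm
  have hcopm : IsCoprime (m : ℤ) p := hcopN.of_isCoprime_of_dvd_left (by exact_mod_cast hm)
  have h1 (c : ℤ) : (N : ℤ) ∣ c - e * a ↔ (N : ℤ) ∣ p * c - a := by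
    rw [show p * c - a = p * (c - e * a) + (p * e - 1) * a by ring,
      dvd_add_left (he.mul_right a)]
    exact ⟨fun h => h.mul_left _, hcopN.dvd_of_dvd_mul_left⟩
  have h2 (d : ℤ) : (m : ℤ) ∣ d - b ↔ (m : ℤ) ∣ p * d - p * b := by
    rw [← mul_sub]
    exact ⟨fun h => h.mul_left _, hcopm.dvd_of_dvd_mul_left⟩
  have h3 (c j d : ℤ) (hc : (N : ℤ) ∣ c - a) :
      (m : ℤ) ∣ d - b ↔ (m : ℤ) ∣ c * j + p * d - p * b := by
    have hmc : (m : ℤ) ∣ c :=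
      (Int.dvd_iff_dvd_of_dvd_sub ((Int.natCast_dvd_natCast.2 hm).trans hc)).2 ha
    rw [h2, add_sub_assoc, dvd_add_right (hmc.mul_right j)]
  have hA : (u, v) ∈ (fun x : ℤ × ℤ => ((p : ℤ) * x.1, x.2)) ''
      coprimePairs N m (e * a) (p * b) ↔
      ((N : ℤ) ∣ u - a ∧ (m : ℤ) ∣ v - p * b) ∧ ∃ c, u = p * c ∧ IsCoprime c v := by
    simp only [Set.mem_image, coprimePairs, Set.mem_ofPred_eq, Prod.exists, Prod.mk.injEq, h1]
    constructor
    · rintro ⟨c, d, ⟨h, h', h''⟩, rfl, rfl⟩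
      exact ⟨⟨h', h''⟩, c, rfl, h⟩
    · rintro ⟨⟨h', h''⟩, c, rfl, h⟩
      exact ⟨c, v, ⟨h, h', h''⟩, rfl, rfl⟩
  have hB (j : ℕ) : (u, v) ∈ (fun x : ℤ × ℤ => (x.1, x.1 * (j : ℤ) + p * x.2)) ''
      coprimePairs N m a b ↔
      ((N : ℤ) ∣ u - a ∧ (m : ℤ) ∣ v - p * b) ∧ ∃ d, v = u * j + p * d ∧ IsCoprime u d := by
    simp only [Set.mem_image, coprimePairs, Set.mem_ofPred_eq, Prod.exists, Prod.mk.injEq]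
    constructor
    · rintro ⟨c, d, ⟨h, h', h''⟩, rfl, rfl⟩
      exact ⟨⟨h', (h3 c j d h').1 h''⟩, d, rfl, h⟩
    · rintro ⟨⟨h', h''⟩, d, rfl, h⟩
      exact ⟨u, d, ⟨h, h', (h3 u j d h').2 h''⟩, rfl, rfl⟩
  have hR : (u, v) ∈ (fun x : ℤ × ℤ => ((p : ℤ) * x.1, (p : ℤ) * x.2)) ''
      coprimePairs N m (e * a) b ↔
      ((N : ℤ) ∣ u - a ∧ (m : ℤ) ∣ v - p * b) ∧
        ∃ c d, u = p * c ∧ v = p * d ∧ IsCoprime c d := by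
    simp only [Set.mem_image, coprimePairs, Set.mem_ofPred_eq, Prod.exists, Prod.mk.injEq, h1, h2]
    constructor
    · rintro ⟨c, d, ⟨h, h', h''⟩, rfl, rfl⟩
      exact ⟨⟨h', h''⟩, c, d, rfl, rfl, h⟩
    · rintro ⟨⟨h', h''⟩, c, d, rfl, rfl, h⟩
      exact ⟨c, d, ⟨h, h', h''⟩, rfl, rfl⟩
  have hP : (u, v) ∈ coprimePairs N m a (p * b) ↔
      ((N : ℤ) ∣ u - a ∧ (m : ℤ) ∣ v - p * b) ∧ IsCoprime u v := and_comm
  simp only [Set.indicator_apply, hA, hB, hR, hP]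
  by_cases hC : (N : ℤ) ∣ u - a ∧ (m : ℤ) ∣ v - p * b
  · have key := congrArg (fun n : ℕ => (n : ℂ) * f (u, v)) (card_coprime_representations hp u v)
    simp only [Finset.card_filter] at key
    push_cast at key
    simpa only [hC, and_self, true_and, add_mul, mul_assoc, Finset.sum_mul, ite_mul, one_mul,
      zero_mul] using key
  · simp [hC]

/-- Hecke operator action on the `Γ₁(N)` Eisenstein series: for a
prime `p ∤ N` and `e` with `p·e ≡ 1 (mod N)`,
`T_p E_k^{(1)}(λ) = p^{k−1}·E_k^{(1)}((λ₁, pλ₂)) + E_k^{(1)}((eλ₁, λ₂))`. -/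
theorem heckeTp_Ek1 (N k : ℕ) (hN : 3 ≤ N) (hk : 3 ≤ k)
    (lam : ℤ × ℤ) (hlam : Int.gcd lam.1 (Int.gcd lam.2 (N : ℤ)) = 1)
    (p : ℕ) (hp : p.Prime) (hpN : ¬ (p ∣ N))
    (e : ℤ) (he : (((p : ℤ) * e : ℤ) : ZMod N) = 1) (τ : ℍ) :
    (p : ℂ) ^ (k - 1) *
        Ek1 k N (e * lam.1, (p : ℤ) * lam.2) (scaleH p hp.pos τ) +
      (1 / (p : ℂ)) * ∑ j ∈ Finset.range p, Ek1 k N lam (shiftH j p hp.pos τ) =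
    (p : ℂ) ^ (k - 1) * Ek1 k N (lam.1, (p : ℤ) * lam.2) τ +
      Ek1 k N (e * lam.1, lam.2) τ := by
  have hpz : (p : ℤ) ≠ 0 := by exact_mod_cast hp.ne_zero
  have hpc : (p : ℂ) ≠ 0 := by exact_mod_cast hp.ne_zero
  have he' : (N : ℤ) ∣ p * e - 1 := by
    rw [← ZMod.intCast_zmod_eq_zero_iff_dvd, Int.cast_sub, he, Int.cast_one, sub_self]
  have hgcd : Int.gcd (e * lam.1) N = Int.gcd lam.1 N := by
    refine Int.gcd_mul_right_left_of_gcd_eq_one (Int.isCoprime_iff_gcd_eq_one.1 ?_)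
    obtain ⟨t, ht⟩ := he'
    exact ⟨p, -t, by linear_combination ht⟩
  have hk1 : (p : ℂ) ^ k = p ^ (k - 1) * p := by
    rw [← pow_succ, Nat.sub_add_cancel (by omega)]
  simp only [Ek1_eq_tsum hN hk, hgcd]
  set m := Int.gcd lam.1 N
  set f := latticeTerm k τ with hf
  have hsum : Summable f := summable_latticeTerm hk τ
  have hscale : latticeTerm k (scaleH p hp.pos τ) =
      f ∘ fun x : ℤ × ℤ => ((p : ℤ) * x.1, x.2) := by
    funext x
    simp only [hf, latticeTerm, scaleH, Function.comp]
    push_cast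
    congr 1
    ring
  have hshift (j : ℕ) : latticeTerm k (shiftH j p hp.pos τ) =
      fun x => (p : ℂ) ^ k * (f ∘ fun x : ℤ × ℤ => (x.1, x.1 * (j : ℤ) + p * x.2)) x := by
    funext x
    have h : (x.1 : ℂ) * ((τ + j) / p) + x.2 =
        (x.1 * τ + ((x.1 * (j : ℤ) + p * x.2 : ℤ) : ℂ)) / p := by
      push_cast
      field_simp
      ring
    simp only [hf, latticeTerm, shiftH, Function.comp, zpow_neg, zpow_natCast]
    rw [h, div_pow, inv_div, div_eq_mul_inv]
  have hmul : f = fun x => (p : ℂ) ^ k *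
      (f ∘ fun x : ℤ × ℤ => ((p : ℤ) * x.1, (p : ℤ) * x.2)) x := by
    funext x
    simp only [hf, latticeTerm, Function.comp, zpow_neg, zpow_natCast]
    rw [← div_eq_mul_inv, ← inv_div, ← div_pow]
    congr 2
    push_cast
    field_simp
  have hind (S : Set (ℤ × ℤ)) (c : ℂ) (g : ℤ × ℤ → ℂ) :
      ∑' x, S.indicator (fun x => c * g x) x = c * ∑' x, S.indicator g x := by
    rw [← tsum_mul_left]
    exact tsum_congr fun x => Set.indicator_const_mul S g c x
  have hinjA : Function.Injective fun x : ℤ × ℤ => ((p : ℤ) * x.1, x.2) := by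
    rintro ⟨c, d⟩ ⟨c', d'⟩ h
    simpa [hp.ne_zero] using h
  have hinjB (j : ℕ) : Function.Injective
      fun x : ℤ × ℤ => (x.1, x.1 * (j : ℤ) + p * x.2) := by
    rintro ⟨c, d⟩ ⟨c', d'⟩ h
    obtain ⟨rfl, h⟩ := Prod.mk.inj h
    simpa [hp.ne_zero] using h
  have hinjR : Function.Injective fun x : ℤ × ℤ => ((p : ℤ) * x.1, (p : ℤ) * x.2) := by
    rintro ⟨c, d⟩ ⟨c', d'⟩ h
    simpa [hp.ne_zero] using h
  have key := tsum_congr (L := .unconditional _) fun y =>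
    indicator_hecke_eq (m := m) (a := lam.1) (b := lam.2) hp hpN
    (Int.natCast_dvd_natCast.1 (Int.gcd_dvd_right lam.1 N)) (Int.gcd_dvd_left lam.1 N) he' f y
  rw [(hsum.indicator _).tsum_add (summable_sum fun j _ => hsum.indicator _),
    Summable.tsum_finsetSum fun j _ => hsum.indicator _,
    (hsum.indicator _).tsum_add ((hsum.indicator _).mul_left _), tsum_mul_left] at key
  have hR : ∑' x, (coprimePairs N m (e * lam.1) lam.2).indicator f x =
      (p : ℂ) ^ k * ∑' y, ((fun x : ℤ × ℤ => ((p : ℤ) * x.1, (p : ℤ) * x.2)) ''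
        coprimePairs N m (e * lam.1) lam.2).indicator f y := by
    rw [← tsum_indicator_comp hinjR, ← hind, ← hmul]
  rw [hR, hscale, tsum_indicator_comp hinjA]
  simp only [hshift, hind]
  simp_rw [← tsum_indicator_comp (hinjB _)] at key
  rw [← Finset.mul_sum, hk1]
  field_simp
  linear_combination key
end
end

section
/- Let N ≥ 3 and k ≥ 3 be integers, let 𝕜 be a subring of ℂ, and let p be a prime with p ∤ N. Define M := {f ∈ span_𝕜{E_k(·, λ̄, N) : λ̄ ∈ Λ_N} : f|_k γ = f for all γ ∈ Γ₁(N)} (the space E_k(Γ₁(N), 𝕜) of weight-k Eisenstein series on Γ₁(N) with coefficients in 𝕜). Then M is stable under the diamond and Hecke operators: (i) for every γ ∈ Γ₀(N) and f ∈ M, the function f|_k γ lies in M; (ii) for every f ∈ M, the function τ ↦ p^{k−1}·(f|_k σ_p)(pτ) + (1/p)·Σ_{j=0}^{p−1} f((τ+j)/p) lies in M, where σ_p is any element of Γ₀(N) whose lower-right entry is congruent to p modulo N. -/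
open scoped MatrixGroups
open Complex UpperHalfPlane

noncomputable section

abbrev SL2Z := Matrix.SpecialLinearGroup (Fin 2) ℤ

/-- weight `k` slash action of `γ ∈ SL(2,ℤ)` on functions `ℍ → ℂ`. -/
def slashf (k : ℤ) (γ : SL2Z) (f : ℍ → ℂ) : ℍ → ℂ :=
  fun τ => (((γ 1 0 : ℤ) : ℂ) * (τ : ℂ) + ((γ 1 1 : ℤ) : ℂ)) ^ (-k) * f (γ • τ)

/-- `f` is a `K`-linear combination of the `E_k(·, λ̄, N)`, `λ̄ ∈ Λ_N`. -/
def inSpanE (k N : ℕ) (K : Set ℂ) (f : ℍ → ℂ) : Prop :=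
  ∃ c : ZMod N × ZMod N → ℂ, (∀ lam, c lam ∈ K) ∧
    ∀ τ : ℍ, f τ = ∑' lam : ZMod N × ZMod N,
      (if addOrderOf lam = N then c lam * Ek k N lam τ else 0)

/-- The weight `k` summand of an Eisenstein series at `z ∈ ℂ`. -/
def eisTerm (k : ℕ) (z : ℂ) (x : ℤ × ℤ) : ℂ :=
  ((x.1 : ℂ) * z + (x.2 : ℂ)) ^ (-(k : ℤ))

/-- The pair `x` is coprime and reduces to `lam` modulo `N`. -/
def IsPrimitiveMod (N : ℕ) (lam : ZMod N × ZMod N) (x : ℤ × ℤ) : Prop :=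
  Int.gcd x.1 x.2 = 1 ∧ (x.1 : ZMod N) = lam.1 ∧ (x.2 : ZMod N) = lam.2

instance (N : ℕ) (lam : ZMod N × ZMod N) : DecidablePred (IsPrimitiveMod N lam) := fun x =>
  inferInstanceAs (Decidable (Int.gcd x.1 x.2 = 1 ∧ (x.1 : ZMod N) = lam.1 ∧ _))

lemma Ek_eq_tsum {N : ℕ} (hN : 3 ≤ N) (k : ℕ) (lam : ZMod N × ZMod N) (τ : ℍ) :
    Ek k N lam τ = ∑' x : ℤ × ℤ, if IsPrimitiveMod N lam x then eisTerm k τ x else 0 := by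
  simp only [Ek, epsN, if_pos hN, one_mul]
  rfl

lemma summable_eisTerm {k : ℕ} (hk : 3 ≤ k) (τ : ℍ) : Summable (eisTerm k τ) :=
  summable_prod_eisSummand hk τ

lemma Summable.ite_zero {α : Type*} {f : α → ℂ} (hf : Summable f) (P : α → Prop)
    [DecidablePred P] : Summable fun x => if P x then f x else 0 := by
  refine Summable.of_norm_bounded hf.norm fun x => ?_
  split_ifs <;> simp

/-- Right multiplication of row vectors by an invertible `2 × 2` matrix with entries `a b c d`,
where `v` is the inverse of the determinant. -/
def rowEquiv {A : Type*} [CommRing A] (a b c d v : A) (h : (a * d - b * c) * v = 1) :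
    A × A ≃+ A × A where
  toFun x := (x.1 * a + x.2 * c, x.1 * b + x.2 * d)
  invFun y := (v * (y.1 * d - y.2 * c), v * (y.2 * a - y.1 * b))
  left_inv x := by
    ext
    · simp only; linear_combination x.1 * h
    · simp only; linear_combination x.2 * h
  right_inv x := by
    ext
    · simp only; linear_combination x.1 * h
    · simp only; linear_combination x.2 * h
  map_add' x y := by ext <;> simp only [Prod.fst_add, Prod.snd_add] <;> ring

lemma SL2Z.det_eq (γ : SL2Z) : γ 0 0 * γ 1 1 - γ 0 1 * γ 1 0 = 1 := by
  have := γ.2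
  rwa [Matrix.det_fin_two] at this

lemma SL2Z.cast_det_eq (N : ℕ) (γ : SL2Z) :
    ((γ 0 0 : ZMod N) * (γ 1 1 : ZMod N) - (γ 0 1 : ZMod N) * (γ 1 0 : ZMod N)) = 1 := by
  exact_mod_cast congrArg (Int.cast : ℤ → ZMod N) γ.det_eq

/-- The right action of `SL(2, ℤ)` on row vectors modulo `N`. -/
def rowAct (N : ℕ) (γ : SL2Z) : ZMod N × ZMod N ≃+ ZMod N × ZMod N :=
  rowEquiv (γ 0 0 : ZMod N) (γ 0 1 : ZMod N) (γ 1 0 : ZMod N) (γ 1 1 : ZMod N) 1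
    (by rw [mul_one, γ.cast_det_eq])

lemma SL2Z.denom_ne_zero (γ : SL2Z) (τ : ℍ) :
    ((γ 1 0 : ℤ) : ℂ) * (τ : ℂ) + ((γ 1 1 : ℤ) : ℂ) ≠ 0 := by
  simpa [UpperHalfPlane.denom] using UpperHalfPlane.denom_ne_zero (γ : GL (Fin 2) ℝ) τ

lemma SL2Z.coe_smul (γ : SL2Z) (τ : ℍ) :
    ((γ • τ : ℍ) : ℂ) = (((γ 0 0 : ℤ) : ℂ) * (τ : ℂ) + ((γ 0 1 : ℤ) : ℂ)) /
      (((γ 1 0 : ℤ) : ℂ) * (τ : ℂ) + ((γ 1 1 : ℤ) : ℂ)) := by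
  rw [UpperHalfPlane.coe_specialLinearGroup_apply]
  simp

lemma slashf_mul (k : ℤ) (γ δ : SL2Z) (f : ℍ → ℂ) :
    slashf k (γ * δ) f = slashf k δ (slashf k γ f) := by
  funext τ
  have h := δ.denom_ne_zero τ
  simp only [slashf, mul_smul, δ.coe_smul, Matrix.SpecialLinearGroup.coe_mul,
    Matrix.two_mul_expl, ← mul_assoc, ← mul_zpow]
  congr 2
  push_cast
  field_simp
  ring

lemma gcd_row_eq_one_iff (γ : SL2Z) (x y : ℤ) :
    Int.gcd (x * γ 0 0 + y * γ 1 0) (x * γ 0 1 + y * γ 1 1) = 1 ↔ Int.gcd x y = 1 := by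
  have hd := γ.det_eq
  rw [← Int.isCoprime_iff_gcd_eq_one, ← Int.isCoprime_iff_gcd_eq_one]
  constructor
  · rintro ⟨s, t, h⟩
    exact ⟨s * γ 0 0 + t * γ 0 1, s * γ 1 0 + t * γ 1 1, by linear_combination h⟩
  · rintro ⟨s, t, h⟩
    exact ⟨s * γ 1 1 - t * γ 0 1, t * γ 0 0 - s * γ 1 0,
      by linear_combination h + (s * x + t * y) * hd⟩

lemma rowAct_cast_eq_iff (N : ℕ) (γ : SL2Z) (lam : ZMod N × ZMod N) (x y : ℤ) :
    (((x * γ 0 0 + y * γ 1 0 : ℤ) : ZMod N) = (rowAct N γ lam).1 ∧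
      ((x * γ 0 1 + y * γ 1 1 : ℤ) : ZMod N) = (rowAct N γ lam).2) ↔
    ((x : ZMod N) = lam.1 ∧ (y : ZMod N) = lam.2) := by
  rw [← Prod.ext_iff (x := ((x : ZMod N), (y : ZMod N))), ← (rowAct N γ).injective.eq_iff,
    Prod.ext_iff]
  simp [rowAct, rowEquiv]

lemma slashf_Ek {N : ℕ} (hN : 3 ≤ N) (k : ℕ) (γ : SL2Z) (lam : ZMod N × ZMod N) :
    slashf k γ (Ek k N lam) = Ek k N (rowAct N γ lam) := by
  funext τ
  have h := γ.denom_ne_zero τ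
  simp only [slashf, Ek_eq_tsum hN, ← tsum_mul_left]
  rw [← (rowEquiv (γ 0 0) (γ 0 1) (γ 1 0) (γ 1 1) 1 (by rw [mul_one, γ.det_eq])).toEquiv.tsum_eq
    (fun x : ℤ × ℤ => if IsPrimitiveMod N (rowAct N γ lam) x then eisTerm k τ x else 0)]
  refine tsum_congr fun x => ?_
  have hP : IsPrimitiveMod N (rowAct N γ lam)
      (x.1 * γ 0 0 + x.2 * γ 1 0, x.1 * γ 0 1 + x.2 * γ 1 1) ↔ IsPrimitiveMod N lam x :=
    and_congr (gcd_row_eq_one_iff γ x.1 x.2) (rowAct_cast_eq_iff N γ lam x.1 x.2)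
  rw [mul_ite, mul_zero]
  refine if_congr hP.symm ?_ rfl
  simp only [eisTerm, rowEquiv, AddEquiv.toEquiv_eq_coe, AddEquiv.coe_toEquiv, AddEquiv.coe_mk,
    Equiv.coe_fn_mk, γ.coe_smul, ← mul_zpow]
  congr 1
  push_cast
  field_simp
  ring

lemma inSpanE_iff {N : ℕ} [NeZero N] (k : ℕ) (K : Set ℂ) (f : ℍ → ℂ) :
    inSpanE k N K f ↔ ∃ c : ZMod N × ZMod N → ℂ, (∀ lam, c lam ∈ K) ∧
      ∀ τ, f τ = ∑ lam, if addOrderOf lam = N then c lam * Ek k N lam τ else 0 := by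
  simp only [inSpanE, tsum_fintype]

lemma inSpanE_of_equiv {N : ℕ} [NeZero N] {k : ℕ} {K : Set ℂ} {f : ℍ → ℂ}
    (c : ZMod N × ZMod N → ℂ) (hc : ∀ lam, c lam ∈ K) (e : ZMod N × ZMod N ≃+ ZMod N × ZMod N)
    (hf : ∀ τ, f τ = ∑ lam, if addOrderOf lam = N then c lam * Ek k N (e lam) τ else 0) :
    inSpanE k N K f := by
  refine (inSpanE_iff k K f).2 ⟨fun lam => c (e.symm lam), fun lam => hc _, fun τ => ?_⟩
  rw [hf]
  exact Fintype.sum_equiv e.toEquiv _ _ fun lam => by simp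

lemma inSpanE.add {N : ℕ} [NeZero N] {k : ℕ} {R : Subring ℂ} {f g : ℍ → ℂ}
    (hf : inSpanE k N R f) (hg : inSpanE k N R g) : inSpanE k N R (fun τ => f τ + g τ) := by
  rw [inSpanE_iff] at hf hg ⊢
  obtain ⟨c, hc, hf⟩ := hf
  obtain ⟨d, hd, hg⟩ := hg
  refine ⟨c + d, fun lam => add_mem (hc lam) (hd lam), fun τ => ?_⟩
  rw [hf, hg, ← Finset.sum_add_distrib]
  refine Finset.sum_congr rfl fun lam _ => ?_
  split_ifs <;> simp [add_mul]

lemma slashf_sum_Ek {N : ℕ} [NeZero N] (hN : 3 ≤ N) {k : ℕ} (γ : SL2Z) {f : ℍ → ℂ}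
    {c : ZMod N × ZMod N → ℂ}
    (hf : ∀ τ, f τ = ∑ lam, if addOrderOf lam = N then c lam * Ek k N lam τ else 0) (τ : ℍ) :
    slashf k γ f τ =
      ∑ lam, if addOrderOf lam = N then c lam * Ek k N (rowAct N γ lam) τ else 0 := by
  simp only [← slashf_Ek hN, slashf, hf, Finset.mul_sum]
  refine Finset.sum_congr rfl fun lam _ => ?_
  split_ifs
  · ring
  · simp

lemma inSpanE.slashf {N : ℕ} [NeZero N] (hN : 3 ≤ N) {k : ℕ} {K : Set ℂ} {f : ℍ → ℂ}
    (hf : inSpanE k N K f) (γ : SL2Z) : inSpanE k N K (slashf k γ f) := by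
  obtain ⟨c, hc, hf⟩ := (inSpanE_iff k K f).1 hf
  exact inSpanE_of_equiv c hc (rowAct N γ) (slashf_sum_Ek hN γ hf)

lemma Gamma1_conj_mem {N : ℕ} {γ δ : SL2Z} (hγ : γ ∈ CongruenceSubgroup.Gamma0 N)
    (hδ : δ ∈ CongruenceSubgroup.Gamma1 N) : γ * δ * γ⁻¹ ∈ CongruenceSubgroup.Gamma1 N := by
  have hd := γ.cast_det_eq N
  rw [CongruenceSubgroup.Gamma0_mem] at hγ
  rw [CongruenceSubgroup.Gamma1_mem] at hδ ⊢
  simp only [hγ, mul_zero, sub_zero] at hd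
  simp only [Matrix.SpecialLinearGroup.coe_mul, Matrix.SpecialLinearGroup.coe_inv,
    Matrix.adjugate_fin_two, Matrix.two_mul_expl]
  simp [hγ, hδ, hd, mul_comm (γ 1 1 : ZMod N)]

lemma slashf_slashf_of_mem_Gamma0 {N : ℕ} {k : ℤ} {f : ℍ → ℂ}
    (hf : ∀ δ ∈ CongruenceSubgroup.Gamma1 N, slashf k δ f = f)
    {γ : SL2Z} (hγ : γ ∈ CongruenceSubgroup.Gamma0 N)
    {δ : SL2Z} (hδ : δ ∈ CongruenceSubgroup.Gamma1 N) :
    slashf k δ (slashf k γ f) = slashf k γ f := by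
  rw [← slashf_mul, ← inv_mul_cancel_right (γ * δ) γ, slashf_mul,
    hf _ (Gamma1_conj_mem hγ hδ)]

lemma slashf_eq_of_mem_Gamma {N : ℕ} [NeZero N] (hN : 3 ≤ N) {k : ℕ} {K : Set ℂ} {f : ℍ → ℂ}
    (hf : inSpanE k N K f) {γ : SL2Z} (hγ : γ ∈ CongruenceSubgroup.Gamma N) :
    slashf k γ f = f := by
  obtain ⟨c, hc, hf⟩ := (inSpanE_iff k K f).1 hf
  have h : rowAct N γ = AddEquiv.refl _ := by
    rw [CongruenceSubgroup.Gamma_mem] at hγ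
    ext lam <;> simp [rowAct, rowEquiv, hγ]
  funext τ
  rw [slashf_sum_Ek hN γ hf, hf, h]
  rfl

lemma slashf_T (k : ℤ) (f : ℍ → ℂ) (τ : ℍ) : slashf k ModularGroup.T f τ = f ((1 : ℝ) +ᵥ τ) := by
  rw [slashf, UpperHalfPlane.modular_T_smul]
  simp [ModularGroup.coe_T]

lemma T_zpow_mem_Gamma1 (N : ℕ) (n : ℤ) :
    ModularGroup.T ^ n ∈ CongruenceSubgroup.Gamma1 N := by
  simp [ModularGroup.coe_T_zpow]

lemma slashf_eq_of_mem_Gamma1 {N : ℕ} [NeZero N] (hN : 3 ≤ N) {k : ℕ} {K : Set ℂ} {f : ℍ → ℂ}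
    (hf : inSpanE k N K f) (hT : slashf k ModularGroup.T f = f)
    {γ : SL2Z} (hγ : γ ∈ CongruenceSubgroup.Gamma1 N) : slashf k γ f = f := by
  have hT' : slashf (k : ℤ) ModularGroup.T⁻¹ f = f := by
    conv_lhs => rw [← hT, ← slashf_mul, mul_inv_cancel]
    funext τ
    simp [slashf]
  have hTn (n : ℤ) : slashf (k : ℤ) (ModularGroup.T ^ n) f = f := by
    induction n with
    | zero => funext τ; simp [slashf]
    | succ n ih => rw [zpow_add_one, slashf_mul, ih, hT]
    | pred n ih => rw [zpow_sub_one, slashf_mul, ih, hT']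
  rw [← inv_mul_cancel_right γ (ModularGroup.T ^ γ 0 1), slashf_mul,
    slashf_eq_of_mem_Gamma hN hf ?_, hTn]
  rw [CongruenceSubgroup.Gamma1_mem] at hγ
  rw [CongruenceSubgroup.Gamma_mem, ← zpow_neg]
  simp only [Matrix.SpecialLinearGroup.coe_mul, ModularGroup.coe_T_zpow, Matrix.two_mul_expl]
  simp [hγ]

lemma tsum_eq_add_tsum_ite {α : Type*} {f : α → ℂ} (hf : Summable f) (Q : α → Prop)
    [DecidablePred Q] :
    ∑' x, f x = (∑' x, if Q x then f x else 0) + ∑' x, if ¬ Q x then f x else 0 := by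
  rw [← (hf.ite_zero Q).tsum_add (hf.ite_zero fun x => ¬ Q x)]
  refine tsum_congr fun x => ?_
  by_cases h : Q x <;> simp [h]

lemma eisTerm_smul (k : ℕ) (z : ℂ) (r c d : ℤ) :
    eisTerm k z (r * c, r * d) = (r : ℂ) ^ (-(k : ℤ)) * eisTerm k z (c, d) := by
  simp only [eisTerm, ← mul_zpow]
  push_cast
  ring_nf

lemma cast_mul_eq_iff {N : ℕ} {p : ℕ} {u : ZMod N} (hu : u * p = 1) (c : ℤ) (a : ZMod N) :
    ((p * c : ℤ) : ZMod N) = a ↔ (c : ZMod N) = u * a := by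
  push_cast
  constructor
  · rintro rfl
    linear_combination -(c : ZMod N) * hu
  · intro h
    rw [h]
    linear_combination a * hu

lemma cast_mul_eq_mul_iff {N : ℕ} {p : ℕ} {u : ZMod N} (hu : u * p = 1) (d : ℤ) (a : ZMod N) :
    ((p * d : ℤ) : ZMod N) = p * a ↔ (d : ZMod N) = a := by
  rw [cast_mul_eq_iff hu, ← mul_assoc, hu, one_mul]

lemma gcd_prime_mul_left_eq_one_iff {p : ℕ} (hp : p.Prime) (c d : ℤ) :
    Int.gcd (p * c) d = 1 ↔ Int.gcd c d = 1 ∧ ¬ (p : ℤ) ∣ d := by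
  have hp' := Nat.prime_iff_prime_int.1 hp
  simp only [← Int.isCoprime_iff_gcd_eq_one, IsCoprime.mul_left_iff,
    hp'.irreducible.coprime_iff_not_dvd]
  exact and_comm

lemma gcd_prime_mul_right_eq_one_iff {p : ℕ} (hp : p.Prime) (c d : ℤ) :
    Int.gcd c (p * d) = 1 ↔ Int.gcd c d = 1 ∧ ¬ (p : ℤ) ∣ c := by
  rw [Int.gcd_comm, gcd_prime_mul_left_eq_one_iff hp, Int.gcd_comm]

lemma isPrimitiveMod_mul_left_iff {N p : ℕ} (hp : p.Prime) {u : ZMod N} (hu : u * p = 1)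
    (lam : ZMod N × ZMod N) (c d : ℤ) :
    IsPrimitiveMod N lam (p * c, d) ↔ IsPrimitiveMod N (u * lam.1, lam.2) (c, d) ∧ ¬ (p : ℤ) ∣ d := by
  simp only [IsPrimitiveMod, gcd_prime_mul_left_eq_one_iff hp, cast_mul_eq_iff hu]
  tauto

lemma isPrimitiveMod_mul_right_iff {N p : ℕ} (hp : p.Prime) {u : ZMod N} (hu : u * p = 1)
    (lam : ZMod N × ZMod N) (c d : ℤ) :
    IsPrimitiveMod N (lam.1, p * lam.2) (c, p * d) ↔ IsPrimitiveMod N lam (c, d) ∧ ¬ (p : ℤ) ∣ c := by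
  simp only [IsPrimitiveMod, gcd_prime_mul_right_eq_one_iff hp, cast_mul_eq_mul_iff hu]
  tauto

lemma isPrimitiveMod_shift_iff (N : ℕ) (lam : ZMod N × ZMod N) (c d m : ℤ) :
    IsPrimitiveMod N lam (c, d + N * m * c) ↔ IsPrimitiveMod N lam (c, d) := by
  simp [IsPrimitiveMod]

lemma injective_mul_fst {p : ℕ} (hp : p.Prime) :
    Function.Injective fun x : ℤ × ℤ => ((p : ℤ) * x.1, x.2) := by
  have := hp.ne_zero
  rintro ⟨a, b⟩ ⟨c, d⟩ h
  simpa [this] using h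

lemma injective_mul_snd {p : ℕ} (hp : p.Prime) :
    Function.Injective fun x : ℤ × ℤ => (x.1, (p : ℤ) * x.2) := by
  have := hp.ne_zero
  rintro ⟨a, b⟩ ⟨c, d⟩ h
  simpa [this] using h

lemma Ek_scaleH {N k p : ℕ} (hN : 3 ≤ N) (hk : 3 ≤ k) (hp : p.Prime) {u : ZMod N}
    (hu : u * p = 1) (lam : ZMod N × ZMod N) (τ : ℍ) :
    Ek k N (u * lam.1, p * lam.2) (scaleH p hp.pos τ) =
      (∑' x, if IsPrimitiveMod N (lam.1, p * lam.2) x ∧ (p : ℤ) ∣ x.1 then eisTerm k τ x else 0) +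
      (p : ℂ) ^ (-(k : ℤ)) *
        ∑' x, if IsPrimitiveMod N (u * lam.1, lam.2) x ∧ ¬ (p : ℤ) ∣ x.1 then
          eisTerm k τ x else 0 := by
  have hterm (x : ℤ × ℤ) : eisTerm k (scaleH p hp.pos τ) x = eisTerm k τ (p * x.1, x.2) := by
    simp only [eisTerm, scaleH]
    push_cast
    ring_nf
  rw [Ek_eq_tsum hN, tsum_eq_add_tsum_ite ((summable_eisTerm hk _).ite_zero _)
    (fun x : ℤ × ℤ => ¬ (p : ℤ) ∣ x.2)]
  congr 1
  · refine Eq.trans ?_ ((injective_mul_fst hp).tsum_eq ?_)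
    · refine tsum_congr fun ⟨c, d⟩ => ?_
      simp only [isPrimitiveMod_mul_left_iff hp hu (lam.1, p * lam.2), dvd_mul_right, and_true,
        hterm, ← ite_and]
      exact if_congr and_comm rfl rfl
    · intro x hx
      obtain ⟨c, hc⟩ : (p : ℤ) ∣ x.1 := by
        by_contra h
        simp [h] at hx
      exact ⟨(c, x.2), Prod.ext hc.symm rfl⟩
  · refine ((injective_mul_snd hp).tsum_eq ?_).symm.trans (Eq.trans ?_ tsum_mul_left)
    rotate_left
    · refine tsum_congr fun x => ?_
      have h := eisTerm_smul k τ p x.1 x.2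
      rw [Int.cast_natCast] at h
      simp only [isPrimitiveMod_mul_right_iff hp hu (u * lam.1, lam.2), dvd_mul_right, not_true,
        not_false_eq_true, if_true, hterm, h, mul_ite, mul_zero]
    · intro x hx
      obtain ⟨d, hd⟩ : (p : ℤ) ∣ x.2 := by
        by_contra h
        simp [h] at hx
      exact ⟨(x.1, d), Prod.ext rfl hd.symm⟩

lemma Ek_shiftH {N k p : ℕ} (hN : 3 ≤ N) (hk : 3 ≤ k) (hp : p.Prime) {u : ZMod N}
    (hu : u * p = 1) (lam : ZMod N × ZMod N) (j : ℕ) (τ : ℍ) :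
    Ek k N lam (shiftH (N * j) p hp.pos τ) =
      (p : ℂ) ^ k * (∑' x : ℤ × ℤ, if (IsPrimitiveMod N (lam.1, p * lam.2) x ∧ ¬ (p : ℤ) ∣ x.1) ∧
        (p : ℤ) ∣ x.2 - N * j * x.1 then eisTerm k τ x else 0) +
      ∑' x : ℤ × ℤ, if IsPrimitiveMod N (u * lam.1, lam.2) x ∧ ¬ (p : ℤ) ∣ x.2 - N * j * x.1 then
          eisTerm k τ x else 0 := by
  have hp0 : (p : ℂ) ≠ 0 := mod_cast hp.ne_zero
  have hterm (x : ℤ × ℤ) : eisTerm k (shiftH (N * j) p hp.pos τ) x =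
      (p : ℂ) ^ k * eisTerm k τ (x.1, p * x.2 + N * j * x.1) := by
    rw [← inv_inv ((p : ℂ) ^ k), ← zpow_natCast, ← zpow_neg, ← inv_zpow]
    simp only [eisTerm, shiftH, ← mul_zpow]
    congr 1
    push_cast
    field_simp
    ring
  have hinj : Function.Injective fun x : ℤ × ℤ => (x.1, (p : ℤ) * x.2 + N * j * x.1) := by
    have := hp.ne_zero
    rintro ⟨a, b⟩ ⟨c, d⟩ h
    simp only [Prod.mk.injEq] at h
    obtain ⟨rfl, h⟩ := h
    simpa [this] using h
  rw [Ek_eq_tsum hN, tsum_eq_add_tsum_ite ((summable_eisTerm hk _).ite_zero _)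
    (fun x : ℤ × ℤ => ¬ (p : ℤ) ∣ x.1)]
  congr 1
  · refine Eq.trans ?_ (congrArg _ (hinj.tsum_eq ?_))
    · rw [← tsum_mul_left]
      refine tsum_congr fun x => ?_
      simp only [isPrimitiveMod_shift_iff, isPrimitiveMod_mul_right_iff hp hu, hterm,
        add_sub_cancel_right, dvd_mul_right, and_true, mul_ite, mul_zero, ← ite_and]
      exact if_congr (by tauto) rfl rfl
    · intro x hx
      obtain ⟨d, hd⟩ : (p : ℤ) ∣ x.2 - N * j * x.1 := by
        by_contra h
        simp [h] at hx
      exact ⟨(x.1, d), Prod.ext rfl (by simp only; linarith)⟩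
  · refine ((injective_mul_fst hp).tsum_eq ?_).symm.trans ?_
    rotate_left
    · rw [← (rowEquiv (1 : ℤ) (N * j) 0 1 1 (by ring)).toEquiv.tsum_eq
        (fun x : ℤ × ℤ => if IsPrimitiveMod N (u * lam.1, lam.2) x ∧
          ¬ (p : ℤ) ∣ x.2 - N * j * x.1 then eisTerm k τ x else 0)]
      refine tsum_congr fun ⟨c, d⟩ => ?_
      have h := eisTerm_smul k τ p c (d + N * j * c)
      rw [Int.cast_natCast, zpow_neg, zpow_natCast,
        show (p * (d + N * j * c) : ℤ) = p * d + N * j * (p * c) by ring] at h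
      have he : (rowEquiv (1 : ℤ) (N * j) 0 1 1 (by ring)).toEquiv (c, d) =
          (c, d + N * j * c) := by
        simp [rowEquiv, add_comm, mul_comm]
      simp only [he, hterm, h, isPrimitiveMod_shift_iff, isPrimitiveMod_mul_left_iff hp hu,
        add_sub_cancel_right, dvd_mul_right, not_true, not_false_eq_true, if_true]
      rw [mul_inv_cancel_left₀ (pow_ne_zero _ hp0)]
    · intro x hx
      obtain ⟨c, hc⟩ : (p : ℤ) ∣ x.1 := by
        by_contra h
        simp [h] at hx
      exact ⟨(c, x.2), Prod.ext hc.symm rfl⟩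

lemma sum_range_ite_dvd_sub {N p : ℕ} (hp : p.Prime) (hpN : ¬ p ∣ N) {c : ℤ}
    (hc : ¬ (p : ℤ) ∣ c) (d : ℤ) (w : ℂ) :
    ∑ j ∈ Finset.range p, (if (p : ℤ) ∣ d - N * j * c then w else 0) = w := by
  have : Fact p.Prime := ⟨hp⟩
  have hc' : (c : ZMod p) ≠ 0 := by rwa [Ne, ZMod.intCast_zmod_eq_zero_iff_dvd]
  have hN' : (N : ZMod p) ≠ 0 := by rwa [Ne, ZMod.natCast_eq_zero_iff]
  have key (j : ℕ) (hj : j ∈ Finset.range p) :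
      (p : ℤ) ∣ d - N * j * c ↔ j = ((d : ZMod p) / (N * c)).val := by
    rw [← ZMod.intCast_zmod_eq_zero_iff_dvd]
    push_cast
    rw [sub_eq_zero, ← ZMod.val_cast_of_lt (Finset.mem_range.1 hj), (ZMod.val_injective p).eq_iff,
      eq_div_iff (mul_ne_zero hN' hc'), ZMod.val_cast_of_lt (Finset.mem_range.1 hj), eq_comm]
    ring_nf
  rw [Finset.sum_congr rfl fun j hj => if_congr (key j hj) rfl rfl, Finset.sum_ite_eq',
    if_pos (Finset.mem_range.2 (ZMod.val_lt _))]

lemma sum_range_ite_not_dvd_sub {N p : ℕ} (hp : p.Prime) (hpN : ¬ p ∣ N) {c d : ℤ}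
    (h : Int.gcd c d = 1) (w : ℂ) :
    ∑ j ∈ Finset.range p, (if ¬ (p : ℤ) ∣ d - N * j * c then w else 0) =
      p * w - if ¬ (p : ℤ) ∣ c then w else 0 := by
  by_cases hc : (p : ℤ) ∣ c
  · have hd : ¬ (p : ℤ) ∣ d := fun hd => hp.one_lt.ne' (by
      have := Int.dvd_coe_gcd hc hd
      rw [h] at this
      exact_mod_cast Int.eq_one_of_dvd_one (by positivity) this)
    have (j : ℕ) : ¬ (p : ℤ) ∣ d - N * j * c := by
      rwa [dvd_sub_left (hc.mul_left _)]
    simp [hc, this]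
  · rw [if_pos hc, eq_sub_iff_add_eq]
    nth_rewrite 2 [← sum_range_ite_dvd_sub hp hpN hc d w]
    rw [← Finset.sum_add_distrib, Finset.sum_congr rfl (g := fun _ => w)]
    · simp
    · intro j _
      split_ifs <;> simp_all

lemma Ek_hecke {N k p : ℕ} (hN : 3 ≤ N) (hk : 3 ≤ k) (hp : p.Prime) (hpN : ¬ p ∣ N) {u : ZMod N}
    (hu : u * p = 1) (lam : ZMod N × ZMod N) (τ : ℍ) :
    (p : ℂ) ^ (k - 1) * Ek k N (u * lam.1, p * lam.2) (scaleH p hp.pos τ) +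
      (1 / (p : ℂ)) * ∑ j ∈ Finset.range p, Ek k N lam (shiftH (N * j) p hp.pos τ) =
    (p : ℂ) ^ (k - 1) * Ek k N (lam.1, p * lam.2) τ + Ek k N (u * lam.1, lam.2) τ := by
  have hp0 : (p : ℂ) ≠ 0 := mod_cast hp.ne_zero
  have hs := summable_eisTerm hk τ
  simp only [Ek_scaleH hN hk hp hu, Ek_shiftH hN hk hp hu, Finset.sum_add_distrib,
    ← Finset.mul_sum]
  rw [← Summable.tsum_finsetSum fun j _ => hs.ite_zero _,
    ← Summable.tsum_finsetSum fun j _ => hs.ite_zero _]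
  have h₁ (x : ℤ × ℤ) : (∑ j ∈ Finset.range p,
      if (IsPrimitiveMod N (lam.1, p * lam.2) x ∧ ¬ (p : ℤ) ∣ x.1) ∧
        (p : ℤ) ∣ x.2 - N * j * x.1 then eisTerm k τ x else 0) =
      if IsPrimitiveMod N (lam.1, p * lam.2) x ∧ ¬ (p : ℤ) ∣ x.1 then eisTerm k τ x else 0 := by
    split_ifs with h
    · simp only [h, not_false_eq_true, and_true, true_and]
      exact sum_range_ite_dvd_sub hp hpN h.2 x.2 _
    · simp only [h, false_and, if_false, Finset.sum_const_zero]
  have h₂ (x : ℤ × ℤ) : (∑ j ∈ Finset.range p,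
      if IsPrimitiveMod N (u * lam.1, lam.2) x ∧ ¬ (p : ℤ) ∣ x.2 - N * j * x.1 then
        eisTerm k τ x else 0) =
      p * (if IsPrimitiveMod N (u * lam.1, lam.2) x then eisTerm k τ x else 0) -
        if IsPrimitiveMod N (u * lam.1, lam.2) x ∧ ¬ (p : ℤ) ∣ x.1 then eisTerm k τ x else 0 := by
    by_cases h : IsPrimitiveMod N (u * lam.1, lam.2) x
    · simp only [h, true_and, if_true]
      exact sum_range_ite_not_dvd_sub hp hpN h.1 _
    · simp only [h, false_and, if_false, Finset.sum_const_zero, mul_zero, sub_zero]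
  simp only [h₁, h₂]
  rw [((hs.ite_zero _).mul_left _).tsum_sub (hs.ite_zero _), tsum_mul_left, ← Ek_eq_tsum hN,
    Ek_eq_tsum hN k (lam.1, p * lam.2),
    tsum_eq_add_tsum_ite (hs.ite_zero (IsPrimitiveMod N (lam.1, p * lam.2)))
      (fun x : ℤ × ℤ => (p : ℤ) ∣ x.1)]
  simp only [← ite_and, and_comm, zpow_neg, zpow_natCast]
  obtain ⟨k, rfl⟩ := Nat.exists_eq_add_of_le' (show 1 ≤ k by omega)
  simp only [Nat.add_sub_cancel]
  field_simp
  ring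

lemma sum_range_shiftH_mul {N p : ℕ} (hp : p.Prime) (hpN : ¬ p ∣ N) {f : ℍ → ℂ}
    (hf : ∀ τ, f ((1 : ℝ) +ᵥ τ) = f τ) (τ : ℍ) :
    ∑ j ∈ Finset.range p, f (shiftH (N * j) p hp.pos τ) =
      ∑ j ∈ Finset.range p, f (shiftH j p hp.pos τ) := by
  have hper : Function.Periodic (fun j => f (shiftH j p hp.pos τ)) p := by
    intro j
    have hp0 : (p : ℂ) ≠ 0 := mod_cast hp.ne_zero
    simp only
    rw [← hf (shiftH j p hp.pos τ)]
    congr 1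
    ext
    simp only [shiftH, UpperHalfPlane.coe_vadd]
    push_cast
    field_simp
    ring
  have hinj : Set.InjOn (fun j => N * j % p) (Finset.range p) := by
    intro i hi j hj hij
    rw [Finset.coe_range, Set.mem_Iio] at hi hj
    have := Nat.ModEq.cancel_left_of_coprime ((Nat.Prime.coprime_iff_not_dvd hp).2 hpN)
      (show N * i ≡ N * j [MOD p] from hij)
    rwa [Nat.ModEq, Nat.mod_eq_of_lt hi, Nat.mod_eq_of_lt hj] at this
  have himage : (Finset.range p).image (fun j => N * j % p) = Finset.range p := by
    refine Finset.eq_of_subset_of_card_le ?_ (Finset.card_image_of_injOn hinj).ge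
    intro i hi
    obtain ⟨j, -, rfl⟩ := Finset.mem_image.1 hi
    exact Finset.mem_range.2 (Nat.mod_lt _ hp.pos)
  conv_rhs => rw [← himage, Finset.sum_image hinj]
  exact Finset.sum_congr rfl fun j _ => (hper.map_mod_nat (N * j)).symm

/-- Slashing by an element of `Γ₀(N)` may be replaced by slashing by one whose upper right entry
vanishes modulo `N`. -/
lemma exists_rowAct_diagonal {N p : ℕ} {k : ℤ} {f : ℍ → ℂ}
    (hf : ∀ δ ∈ CongruenceSubgroup.Gamma1 N, slashf k δ f = f) {σ : SL2Z}
    (hσ : σ ∈ CongruenceSubgroup.Gamma0 N) (hσp : ((σ 1 1 : ℤ) : ZMod N) = (p : ZMod N)) :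
    ∃ (σ' : SL2Z) (u : ZMod N), u * p = 1 ∧ slashf k σ' f = slashf k σ f ∧
      ∀ lam, rowAct N σ' lam = (u * lam.1, p * lam.2) := by
  have hd := σ.cast_det_eq N
  rw [CongruenceSubgroup.Gamma0_mem.1 hσ, hσp, mul_zero, sub_zero] at hd
  refine ⟨σ * ModularGroup.T ^ (-(σ 0 1 * p)), (σ 0 0 : ZMod N), hd, ?_, fun lam => ?_⟩
  · rw [slashf_mul, slashf_slashf_of_mem_Gamma0 hf hσ (T_zpow_mem_Gamma1 N _)]
  · rw [CongruenceSubgroup.Gamma0_mem] at hσ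
    simp only [rowAct, rowEquiv, AddEquiv.coe_mk, Equiv.coe_fn_mk,
      Matrix.SpecialLinearGroup.coe_mul, ModularGroup.coe_T_zpow, Matrix.two_mul_expl]
    ext
    · simp [hσ, mul_comm]
    · simp only [Matrix.of_apply, Matrix.cons_val', Matrix.cons_val_zero, Matrix.cons_val_one,
        Matrix.cons_val_fin_one]
      push_cast
      rw [hσ, hσp]
      linear_combination -lam.1 * (σ 0 1 : ZMod N) * hd

/-- The Hecke operator `T_p`, with the diamond operator given by slashing with `σ`. -/
def heckeT (k p : ℕ) (hp : 0 < p) (σ : SL2Z) (f : ℍ → ℂ) : ℍ → ℂ :=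
  fun τ => (p : ℂ) ^ (k - 1) * slashf (k : ℤ) σ f (scaleH p hp τ) +
    (1 / (p : ℂ)) * ∑ j ∈ Finset.range p, f (shiftH j p hp τ)

lemma inSpanE_heckeT {N k p : ℕ} [NeZero N] (hN : 3 ≤ N) (hk : 3 ≤ k) {R : Subring ℂ}
    (hp : p.Prime) (hpN : ¬ p ∣ N) {f : ℍ → ℂ} (hfR : inSpanE k N R f)
    (hf : ∀ δ ∈ CongruenceSubgroup.Gamma1 N, slashf k δ f = f) {σ : SL2Z}
    (hσ : σ ∈ CongruenceSubgroup.Gamma0 N) (hσp : ((σ 1 1 : ℤ) : ZMod N) = (p : ZMod N)) :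
    inSpanE k N R (heckeT k p hp.pos σ f) := by
  obtain ⟨σ', u, hu, hσ', hrow⟩ := exists_rowAct_diagonal hf hσ hσp
  obtain ⟨c, hc, hfc⟩ := (inSpanE_iff k R f).1 hfR
  have hT (τ : ℍ) : f ((1 : ℝ) +ᵥ τ) = f τ := by
    rw [← slashf_T k f, hf _ (by simp)]
  have hexp (τ : ℍ) : heckeT k p hp.pos σ f τ =
      (∑ lam, if addOrderOf lam = N then (c lam * (p : ℂ) ^ (k - 1)) *
        Ek k N (rowEquiv (1 : ZMod N) 0 0 p u (by linear_combination hu) lam) τ else 0) +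
      ∑ lam, if addOrderOf lam = N then
        c lam * Ek k N (rowEquiv u 0 0 1 p (by linear_combination hu) lam) τ else 0 := by
    rw [heckeT, ← sum_range_shiftH_mul hp hpN hT, ← hσ', slashf_sum_Ek hN σ' hfc]
    simp only [hfc]
    rw [Finset.sum_comm, Finset.mul_sum, Finset.mul_sum, ← Finset.sum_add_distrib,
      ← Finset.sum_add_distrib]
    refine Finset.sum_congr rfl fun lam _ => ?_
    split_ifs
    · have h := Ek_hecke hN hk hp hpN hu lam τ
      have h₁ : rowEquiv (1 : ZMod N) 0 0 p u (by linear_combination hu) lam =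
          (lam.1, p * lam.2) := by simp [rowEquiv, mul_comm]
      have h₂ : rowEquiv u 0 0 1 (p : ZMod N) (by linear_combination hu) lam =
          (u * lam.1, lam.2) := by simp [rowEquiv, mul_comm]
      rw [h₁, h₂, hrow, ← Finset.mul_sum]
      linear_combination c lam * h
    · simp
  rw [funext hexp]
  exact (inSpanE_of_equiv (fun lam => c lam * (p : ℂ) ^ (k - 1))
    (fun lam => mul_mem (hc lam) (pow_mem (natCast_mem R p) _)) _ fun _ => rfl).add
    (inSpanE_of_equiv c hc _ fun _ => rfl)

lemma heckeT_vadd_one {N k p : ℕ} (hp : p.Prime) {f : ℍ → ℂ}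
    (hf : ∀ δ ∈ CongruenceSubgroup.Gamma1 N, slashf k δ f = f) {σ : SL2Z}
    (hσ : σ ∈ CongruenceSubgroup.Gamma0 N) (τ : ℍ) :
    heckeT k p hp.pos σ f ((1 : ℝ) +ᵥ τ) = heckeT k p hp.pos σ f τ := by
  have hp0 : (p : ℂ) ≠ 0 := mod_cast hp.ne_zero
  have hTmem : ModularGroup.T ∈ CongruenceSubgroup.Gamma1 N := by simp
  have hT (τ : ℍ) : f ((1 : ℝ) +ᵥ τ) = f τ := by rw [← slashf_T k f, hf _ hTmem]
  have hTσ (n : ℕ) (τ : ℍ) : slashf k σ f ((n : ℝ) +ᵥ τ) = slashf k σ f τ := by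
    induction n with
    | zero => simp
    | succ n ih =>
      rw [Nat.cast_succ, add_comm, add_vadd, ← slashf_T k (slashf k σ f),
        slashf_slashf_of_mem_Gamma0 hf hσ hTmem, ih]
  have hscale : scaleH p hp.pos ((1 : ℝ) +ᵥ τ) = (p : ℝ) +ᵥ scaleH p hp.pos τ := by
    ext
    simp only [scaleH, UpperHalfPlane.coe_vadd]
    push_cast
    ring
  have hshift (j : ℕ) : shiftH j p hp.pos ((1 : ℝ) +ᵥ τ) = shiftH (j + 1) p hp.pos τ := by
    ext
    simp only [shiftH, UpperHalfPlane.coe_vadd]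
    push_cast
    ring
  have hlast : f (shiftH p p hp.pos τ) = f (shiftH 0 p hp.pos τ) := by
    rw [← hT (shiftH 0 p hp.pos τ)]
    congr 1
    ext
    simp only [shiftH, UpperHalfPlane.coe_vadd]
    push_cast
    field_simp
    ring
  simp only [heckeT, hscale, hTσ, hshift]
  congr 2
  have h := Finset.sum_range_succ (fun j => f (shiftH j p hp.pos τ)) p
  rw [Finset.sum_range_succ', hlast] at h
  exact add_right_cancel h

/-- The space `E_k(Γ₁(N), 𝕜)` of weight-`k` Eisenstein series on
`Γ₁(N)` with coefficients in a subring `𝕜 ⊆ ℂ` is stable under (i) the diamond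
operators (slashing by `Γ₀(N)`) and (ii) the Hecke operator `T_p` for primes `p ∤ N`. -/
theorem eisenstein_stable_diamond_hecke (N k : ℕ) (hN : 3 ≤ N) (hk : 3 ≤ k)
    (R : Subring ℂ) (p : ℕ) (hp : p.Prime) (hpN : ¬ (p ∣ N)) :
    (∀ γ ∈ CongruenceSubgroup.Gamma0 N,
      ∀ f : ℍ → ℂ,
        (inSpanE k N (R : Set ℂ) f ∧
          ∀ δ ∈ CongruenceSubgroup.Gamma1 N, slashf (k : ℤ) δ f = f) →
        (inSpanE k N (R : Set ℂ) (slashf (k : ℤ) γ f) ∧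
          ∀ δ ∈ CongruenceSubgroup.Gamma1 N,
            slashf (k : ℤ) δ (slashf (k : ℤ) γ f) = slashf (k : ℤ) γ f)) ∧
    (∀ f : ℍ → ℂ,
      (inSpanE k N (R : Set ℂ) f ∧
        ∀ δ ∈ CongruenceSubgroup.Gamma1 N, slashf (k : ℤ) δ f = f) →
      ∀ σp ∈ CongruenceSubgroup.Gamma0 N, ((σp 1 1 : ℤ) : ZMod N) = (p : ZMod N) →
        (inSpanE k N (R : Set ℂ)
            (fun τ => (p : ℂ) ^ (k - 1) * slashf (k : ℤ) σp f (scaleH p hp.pos τ) +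
              (1 / (p : ℂ)) * ∑ j ∈ Finset.range p, f (shiftH j p hp.pos τ)) ∧
          ∀ δ ∈ CongruenceSubgroup.Gamma1 N,
            slashf (k : ℤ) δ
              (fun τ => (p : ℂ) ^ (k - 1) * slashf (k : ℤ) σp f (scaleH p hp.pos τ) +
                (1 / (p : ℂ)) * ∑ j ∈ Finset.range p, f (shiftH j p hp.pos τ)) =
            (fun τ => (p : ℂ) ^ (k - 1) * slashf (k : ℤ) σp f (scaleH p hp.pos τ) +
              (1 / (p : ℂ)) * ∑ j ∈ Finset.range p, f (shiftH j p hp.pos τ)))) := by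
  have : NeZero N := ⟨by omega⟩
  refine ⟨fun γ hγ f ⟨hfR, hf⟩ => ⟨hfR.slashf hN γ, fun δ hδ =>
    slashf_slashf_of_mem_Gamma0 hf hγ hδ⟩, fun f ⟨hfR, hf⟩ σ hσ hσp => ?_⟩
  have hspan := inSpanE_heckeT hN hk hp hpN hfR hf hσ hσp
  refine ⟨hspan, fun δ hδ => slashf_eq_of_mem_Gamma1 hN hspan (funext fun τ => ?_) hδ⟩
  rw [slashf_T, heckeT_vadd_one hp hf hσ]
end
end
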